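/- arXiv:2605.24136 — 3 statements merged into one kernel-verified Lean document; each statement's English description precedes it below -/
import Mathlib

section
/- Let Ω be a measurable space, let P₀ and P₁ be probability measures on Ω, let Z : Ω → X be a measurable map into a measurable space X, let E₀, E₁ ⊆ Ω be measurable events, and let δ ∈ [0,1), ε ≥ 0. Assume P₀(E₀) ≥ 1 − δ and P₁(E₁) ≥ 1 − δ, and assume there exists a probability measure π on X such that TV((Z under P₀ conditioned on E₀), π) ≤ ε and TV((Z under P₁ conditioned on E₁), π) ≤ ε, where 'Z under Pᵢ conditioned on Eᵢ' denotes the pushforward by Z of the conditional measure Pᵢ(· | Eᵢ). Then every measurable classifier g : X → {0,1} satisfies (1/2)·P₀({ω : g(Z ω) = 1}) + (1/2)·P₁({ω : g(Z ω) = 0}) ≥ (1 − δ)·(1/2 − ε). -/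
open MeasureTheory ProbabilityTheory

/-- Total variation distance between two measures:
`TV(μ, ν) = sup_{A measurable} |μ(A) − ν(A)|`. -/
noncomputable def tv {X : Type*} [MeasurableSpace X] (μ ν : Measure X) : ℝ :=
  ⨆ A : {A : Set X // MeasurableSet A}, |(μ A.1).toReal - (ν A.1).toReal|

/-- The values of two probability measures on a measurable set differ by at most their total
variation distance. -/
theorem abs_sub_le_tv {X : Type*} [MeasurableSpace X] (μ ν : Measure X)
    [IsProbabilityMeasure μ] [IsProbabilityMeasure ν] {A : Set X} (hA : MeasurableSet A) :
    |(μ A).toReal - (ν A).toReal| ≤ tv μ ν := by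
  refine le_ciSup (f := fun B : {B : Set X // MeasurableSet B} =>
    |(μ B.1).toReal - (ν B.1).toReal|) ⟨1, ?_⟩ ⟨A, hA⟩
  rintro _ ⟨B, rfl⟩
  exact abs_sub_le_of_nonneg_of_le ENNReal.toReal_nonneg measureReal_le_one
    ENNReal.toReal_nonneg measureReal_le_one

/-- If `E` has probability at least `c > 0` and the law of `Z` conditioned on `E` is within `ε` of
`π` in total variation, then `Z` lies in `A` with probability at least `c * (π A - ε)`. -/
theorem mul_sub_le_measure_preimage {Ω X : Type*} [MeasurableSpace Ω] [MeasurableSpace X]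
    (P : Measure Ω) [IsProbabilityMeasure P] {Z : Ω → X} (hZ : Measurable Z)
    {E : Set Ω} (hE : MeasurableSet E) {c ε : ℝ} (hc : 0 < c) (hPE : c ≤ (P E).toReal)
    (π : Measure X) [IsProbabilityMeasure π] (hmix : tv ((P[|E]).map Z) π ≤ ε)
    {A : Set X} (hA : MeasurableSet A) :
    c * ((π A).toReal - ε) ≤ (P (Z ⁻¹' A)).toReal := by
  have hE0 : P E ≠ 0 := fun h => by simp [h] at hPE; linarith
  have : IsProbabilityMeasure (P[|E]) := cond_isProbabilityMeasure hE0
  have : IsProbabilityMeasure ((P[|E]).map Z) :=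
    Measure.isProbabilityMeasure_map hZ.aemeasurable
  have hdist := (abs_le.mp ((abs_sub_le_tv _ π hA).trans hmix)).1
  rw [Measure.map_apply hZ hA] at hdist
  have hmul : (P[Z ⁻¹' A | E]).toReal * (P E).toReal ≤ (P (Z ⁻¹' A)).toReal := by
    rw [← ENNReal.toReal_mul, cond_mul_eq_inter hE]
    exact ENNReal.toReal_mono (measure_ne_top _ _) (measure_mono Set.inter_subset_right)
  calc c * ((π A).toReal - ε) ≤ c * (P[Z ⁻¹' A | E]).toReal := by gcongr; linarith
    _ ≤ (P E).toReal * (P[Z ⁻¹' A | E]).toReal := by gcongr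
    _ ≤ (P (Z ⁻¹' A)).toReal := by linarith

/-- If `P₀(E₀) ≥ 1 − δ`, `P₁(E₁) ≥ 1 − δ` and there is a probability measure `π` with
`TV(law of Z under Pᵢ conditioned on Eᵢ, π) ≤ ε` for `i = 0, 1`, then every measurable
classifier `g : X → {0,1}` (here `Bool`) has balanced risk
`(1/2)·P₀ {g ∘ Z = 1} + (1/2)·P₁ {g ∘ Z = 0} ≥ (1 − δ)·(1/2 − ε)`. -/
theorem stmt_2 {Ω X : Type*} [MeasurableSpace Ω] [MeasurableSpace X]
    (P₀ P₁ : Measure Ω) [IsProbabilityMeasure P₀] [IsProbabilityMeasure P₁]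
    (Z : Ω → X) (hZ : Measurable Z)
    (E₀ E₁ : Set Ω) (hE₀ : MeasurableSet E₀) (hE₁ : MeasurableSet E₁)
    (δ ε : ℝ) (hδ0 : 0 ≤ δ) (hδ1 : δ < 1) (hε : 0 ≤ ε)
    (h0 : 1 - δ ≤ (P₀ E₀).toReal) (h1 : 1 - δ ≤ (P₁ E₁).toReal)
    (π : Measure X) [IsProbabilityMeasure π]
    (hmix0 : tv ((P₀[|E₀]).map Z) π ≤ ε)
    (hmix1 : tv ((P₁[|E₁]).map Z) π ≤ ε)
    (g : X → Bool) (hg : Measurable g) :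
    (1 - δ) * (1 / 2 - ε) ≤
      (1 / 2) * (P₀ {ω | g (Z ω) = true}).toReal
        + (1 / 2) * (P₁ {ω | g (Z ω) = false}).toReal := by
  have hA : MeasurableSet (g ⁻¹' {true}) := hg (measurableSet_singleton _)
  have hcompl : g ⁻¹' {false} = (g ⁻¹' {true})ᶜ := by ext; simp
  have hb0 := mul_sub_le_measure_preimage P₀ hZ hE₀ (sub_pos.mpr hδ1) h0 π hmix0 hA
  have hb1 := mul_sub_le_measure_preimage P₁ hZ hE₁ (sub_pos.mpr hδ1) h1 π hmix1
    (hg (measurableSet_singleton false))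
  have hsum : (π (g ⁻¹' {false})).toReal = 1 - (π (g ⁻¹' {true})).toReal := by
    rw [hcompl]
    exact probReal_compl_eq_one_sub hA
  rw [hsum] at hb1
  change _ ≤ 1 / 2 * (P₀ (Z ⁻¹' (g ⁻¹' {true}))).toReal
    + 1 / 2 * (P₁ (Z ⁻¹' (g ⁻¹' {false}))).toReal
  linarith
end

section
/- Let Ω be a measurable space, let P₀ and P₁ be probability measures on Ω, let Z : Ω → X be a measurable map into a measurable space X, let E₀, E₁ ⊆ Ω be measurable events, and let δ ∈ [0,1), ε ≥ 0. Assume P₀(E₀) ≥ 1 − δ and P₁(E₁) ≥ 1 − δ, and assume there exists a probability measure π on X such that TV((Z under P₀ conditioned on E₀), π) ≤ ε and TV((Z under P₁ conditioned on E₁), π) ≤ ε. Then the pushforward laws μᵢ = law of Z under Pᵢ satisfy TV(μ₀, μ₁) ≤ δ + 2ε. -/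
open MeasureTheory ProbabilityTheory

theorem abs_measure_sub_le_tv {X : Type*} [MeasurableSpace X] (μ ν : Measure X)
    [IsFiniteMeasure μ] [IsFiniteMeasure ν] {A : Set X} (hA : MeasurableSet A) :
    |(μ A).toReal - (ν A).toReal| ≤ tv μ ν := by
  refine le_ciSup (f := fun A : {A : Set X // MeasurableSet A} =>
    |(μ A.1).toReal - (ν A.1).toReal|) ⟨μ.real Set.univ + ν.real Set.univ, ?_⟩ ⟨A, hA⟩
  rintro _ ⟨B, rfl⟩
  have hμ : μ.real B.1 ≤ μ.real Set.univ := measureReal_mono (Set.subset_univ _)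
  have hν : ν.real B.1 ≤ ν.real Set.univ := measureReal_mono (Set.subset_univ _)
  have hμ0 : 0 ≤ μ.real B.1 := measureReal_nonneg
  have hν0 : 0 ≤ ν.real B.1 := measureReal_nonneg
  simp only [← measureReal_def]
  exact abs_le.2 ⟨by linarith, by linarith⟩

/-- If `P E ≥ 1 - δ`, then `P B` lies within `δ` above `(1 - δ) * P[B | E]`. -/
theorem measureReal_mem_Icc_of_cond {Ω : Type*} [MeasurableSpace Ω] (P : Measure Ω)
    [IsProbabilityMeasure P] {E : Set Ω} (hE : MeasurableSet E) {δ : ℝ}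
    (h : 1 - δ ≤ P.real E) (B : Set Ω) :
    P.real B ∈ Set.Icc ((1 - δ) * P[|E].real B) ((1 - δ) * P[|E].real B + δ) := by
  have hmul : P[|E].real B * P.real E = P.real (E ∩ B) := by
    rw [measureReal_def, measureReal_def, measureReal_def, ← ENNReal.toReal_mul,
      cond_mul_eq_inter hE]
  have hsplit : P.real (B ∩ E) + P.real (B \ E) = P.real B := measureReal_inter_add_sdiff hE
  rw [Set.inter_comm, ← hmul] at hsplit
  have hdiff : P.real (B \ E) ≤ 1 - P.real E := by
    rw [← probReal_compl_eq_one_sub hE]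
    exact measureReal_mono fun _ hx => hx.2
  have hdiff0 : 0 ≤ P.real (B \ E) := measureReal_nonneg
  have hc0 : 0 ≤ P[|E].real B := measureReal_nonneg
  have hc1 : P[|E].real B ≤ 1 := measureReal_le_one
  constructor <;> nlinarith

/-- If `P₀(E₀) ≥ 1 − δ`, `P₁(E₁) ≥ 1 − δ` and there is a probability measure `π` with
`TV(law of Z under Pᵢ conditioned on Eᵢ, π) ≤ ε` for `i = 0, 1`, then the pushforward
laws `μᵢ = (Pᵢ).map Z` satisfy `TV(μ₀, μ₁) ≤ δ + 2ε`. -/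
theorem stmt_5 {Ω X : Type*} [MeasurableSpace Ω] [MeasurableSpace X]
    (P₀ P₁ : Measure Ω) [IsProbabilityMeasure P₀] [IsProbabilityMeasure P₁]
    (Z : Ω → X) (hZ : Measurable Z)
    (E₀ E₁ : Set Ω) (hE₀ : MeasurableSet E₀) (hE₁ : MeasurableSet E₁)
    (δ ε : ℝ) (hδ0 : 0 ≤ δ) (hδ1 : δ < 1) (hε : 0 ≤ ε)
    (h0 : 1 - δ ≤ (P₀ E₀).toReal) (h1 : 1 - δ ≤ (P₁ E₁).toReal)
    (π : Measure X) [IsProbabilityMeasure π]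
    (hmix0 : tv ((P₀[|E₀]).map Z) π ≤ ε)
    (hmix1 : tv ((P₁[|E₁]).map Z) π ≤ ε) :
    tv (P₀.map Z) (P₁.map Z) ≤ δ + 2 * ε := by
  have hP₀ : P₀ E₀ ≠ 0 := fun h => by simp only [h, ENNReal.toReal_zero] at h0; linarith
  have hP₁ : P₁ E₁ ≠ 0 := fun h => by simp only [h, ENNReal.toReal_zero] at h1; linarith
  have := cond_isProbabilityMeasure hP₀
  have := cond_isProbabilityMeasure hP₁
  have : Nonempty {A : Set X // MeasurableSet A} := ⟨⟨∅, .empty⟩⟩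
  refine ciSup_le fun ⟨A, hA⟩ => ?_
  have d0 := abs_le.1 ((abs_measure_sub_le_tv _ π hA).trans hmix0)
  have d1 := abs_le.1 ((abs_measure_sub_le_tv _ π hA).trans hmix1)
  obtain ⟨l0, u0⟩ := measureReal_mem_Icc_of_cond P₀ hE₀ h0 (Z ⁻¹' A)
  obtain ⟨l1, u1⟩ := measureReal_mem_Icc_of_cond P₁ hE₁ h1 (Z ⁻¹' A)
  simp only [Measure.map_apply hZ hA, ← measureReal_def] at d0 d1 ⊢
  rw [abs_le]
  constructor <;> nlinarith [mul_nonneg hδ0 hε]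
end

section
/- Let X be a standard Borel space, let κ be a Markov kernel from X to X, and for x ∈ X let P_x denote the law (given by the Ionescu–Tulcea construction) of the time-homogeneous Markov chain (X_n)_{n≥0} on the path space ℕ → X with X_0 = x and one-step transitions κ. For a measurable set w ⊆ X, let τ_w = inf{n ≥ 1 : X_n ∉ w} be the first exit time from w. Let w, w' ⊆ X be disjoint measurable sets, let x₀, x₁ ∈ X, let T, t* ∈ ℕ with 1 ≤ t* < T, let δ ≥ 0, and suppose P_{x₀}(τ_w < T) ≤ δ and P_{x₁}(τ_{w'} < T) ≤ δ. Then the classifier g defined by g x = 1 if x ∈ w' and g x = 0 otherwise satisfies (1/2)·P_{x₀}({X_{t*} ∈ w'}) + (1/2)·P_{x₁}({X_{t*} ∉ w'}) ≤ δ. Consequently, the infimum over all measurable classifiers g : X → {0,1} of (1/2)·P_{x₀}({g(X_{t*}) = 1}) + (1/2)·P_{x₁}({g(X_{t*}) = 0}) is at most δ. -/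
open MeasureTheory ProbabilityTheory

/-- First exit time `τ_w = inf {n ≥ 1 : ω n ∉ w}` of a path `ω : ℕ → X` from a set `w`,
valued in `ℕ∞` (so that it is `⊤` if the path never exits). -/
noncomputable def exitTime {X : Type*} (w : Set X) (ω : ℕ → X) : ℕ∞ :=
  sInf ((fun n : ℕ => (n : ℕ∞)) '' {n : ℕ | 1 ≤ n ∧ ω n ∉ w})

theorem exitTime_lt_of_notMem {X : Type*} {w : Set X} {ω : ℕ → X} {n T : ℕ}
    (hn : 1 ≤ n) (hnT : n < T) (hω : ω n ∉ w) : exitTime w ω < (T : ℕ∞) :=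
  (sInf_le ⟨n, ⟨hn, hω⟩, rfl⟩ : exitTime w ω ≤ n).trans_lt (by exact_mod_cast hnT)

theorem measure_notMem_le_measure_exitTime_lt {X : Type*} [MeasurableSpace X]
    (μ : Measure (ℕ → X)) [IsFiniteMeasure μ] (w : Set X) {n T : ℕ}
    (hn : 1 ≤ n) (hnT : n < T) :
    (μ {ω | ω n ∉ w}).toReal ≤ (μ {ω | exitTime w ω < (T : ℕ∞)}).toReal :=
  measureReal_mono fun _ hω => exitTime_lt_of_notMem hn hnT hω

/-- Part 2 of the Basin Identifiability theorem. `X` is a standard Borel space, `κ` a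
Markov kernel on `X`, and `P` the family of laws of the time-homogeneous Markov chain
with transition kernel `κ` on path space `ℕ → X`; the Ionescu–Tulcea law is characterized
by: `P x`-a.s. the path starts at `x`, and the law of the shifted path
`n ↦ ω (n+1)` under `P x` is `∫ P y ∂κ(x, ·)`. If `w, w'` are disjoint measurable sets,
trajectories from `x₀` exit `w` before time `T` with probability at most `δ`, and
trajectories from `x₁` exit `w'` before time `T` with probability at most `δ`, then for
`1 ≤ t* < T` the classifier predicting `1` exactly on `w'` has balanced risk
`(1/2)·P_{x₀}(X_{t*} ∈ w') + (1/2)·P_{x₁}(X_{t*} ∉ w') ≤ δ`; consequently the infimum of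
the balanced risk over all measurable classifiers `g : X → {0,1}` (here `Bool`) is at
most `δ`. -/
theorem stmt_7 {X : Type*} [MeasurableSpace X] [StandardBorelSpace X]
    (κ : Kernel X X) [IsMarkovKernel κ]
    (P : Kernel X (ℕ → X)) [IsMarkovKernel P]
    (hstart : ∀ x : X, P x {ω | ω 0 = x} = 1)
    (hshift : ∀ x : X, (P x).map (fun ω n => ω (n + 1)) = (κ x).bind (fun y => P y))
    (w w' : Set X) (hw : MeasurableSet w) (hw' : MeasurableSet w')
    (hdisj : Disjoint w w')
    (x₀ x₁ : X) (T tstar : ℕ) (ht1 : 1 ≤ tstar) (ht : tstar < T)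
    (δ : ℝ) (hδ : 0 ≤ δ)
    (hexit0 : (P x₀ {ω | exitTime w ω < (T : ℕ∞)}).toReal ≤ δ)
    (hexit1 : (P x₁ {ω | exitTime w' ω < (T : ℕ∞)}).toReal ≤ δ) :
    (1 / 2) * (P x₀ {ω | ω tstar ∈ w'}).toReal
      + (1 / 2) * (P x₁ {ω | ω tstar ∉ w'}).toReal ≤ δ ∧
    sInf {r : ℝ | ∃ g : X → Bool, Measurable g ∧
        r = (1 / 2) * (P x₀ {ω | g (ω tstar) = true}).toReal
          + (1 / 2) * (P x₁ {ω | g (ω tstar) = false}).toReal} ≤ δ := by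
  classical
  have h0 : (P x₀ {ω | ω tstar ∈ w'}).toReal ≤ δ :=
    (measureReal_mono (μ := P x₀) (s₂ := {ω | ω tstar ∉ w})
      fun _ hω => hdisj.notMem_of_mem_right hω).trans
      ((measure_notMem_le_measure_exitTime_lt (P x₀) w ht1 ht).trans hexit0)
  have h1 : (P x₁ {ω | ω tstar ∉ w'}).toReal ≤ δ :=
    (measure_notMem_le_measure_exitTime_lt (P x₁) w' ht1 ht).trans hexit1
  have hrisk : (1 / 2) * (P x₀ {ω | ω tstar ∈ w'}).toReal
      + (1 / 2) * (P x₁ {ω | ω tstar ∉ w'}).toReal ≤ δ := by linarith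
  refine ⟨hrisk, csInf_le_of_le ?_ ?_ hrisk⟩
  · refine ⟨0, ?_⟩
    rintro r ⟨g, -, rfl⟩
    positivity
  · refine ⟨fun x => decide (x ∈ w'), measurable_to_bool ?_, by simp⟩
    simpa [Set.preimage] using hw'
end
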